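/- Work in ℝ[x, y] with fraction field ℝ(x, y). Set t = xy − 1, h = t(xt + 1), f = (xt + 1)²(t² + y), P = f + h, q = −t² − 6th(h + 1), u = 170fh + 91h² + 195fh² + 69h³ + 75fh³ + (75/4)h⁴, and Q = q − u. Then h is integral over the subring ℝ[P, Q] of ℝ(x, y), and the monic minimal polynomial m(T) of h over the field ℝ(P, Q) satisfies (197/4)·m(T) = R(T), where R(T) = (197/4)T⁶ + (104 − (363/2)P)T⁵ + (63 − 421P + (825/4)P²)T⁴ + (−306P + 510P² − 75P³)T³ + (−Q + 412P² − 195P³)T² + (2PQ − 170P³)T − P²Q. In particular R(h) = 0 in ℝ(x, y) and R(T) is irreducible in ℝ(P, Q)[T]. -/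

import Mathlib

noncomputable section

open MvPolynomial

/-- `t = xy − 1`. -/
def pinchukT : MvPolynomial (Fin 2) ℝ := X 0 * X 1 - 1

/-- `h = t(xt + 1)`. -/
def pinchukH : MvPolynomial (Fin 2) ℝ := pinchukT * (X 0 * pinchukT + 1)

/-- `f = (xt + 1)²(t² + y)`. -/
def pinchukF : MvPolynomial (Fin 2) ℝ :=
  (X 0 * pinchukT + 1) ^ 2 * (pinchukT ^ 2 + X 1)

/-- `P = f + h`. -/
def pinchukP : MvPolynomial (Fin 2) ℝ := pinchukF + pinchukH

/-- `q = −t² − 6th(h + 1)`. -/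
def pinchukq : MvPolynomial (Fin 2) ℝ :=
  -pinchukT ^ 2 - 6 * pinchukT * pinchukH * (pinchukH + 1)

/-- `u = 170fh + 91h² + 195fh² + 69h³ + 75fh³ + (75/4)h⁴`. -/
def pinchukU : MvPolynomial (Fin 2) ℝ :=
  170 * pinchukF * pinchukH + 91 * pinchukH ^ 2 + 195 * pinchukF * pinchukH ^ 2 +
    69 * pinchukH ^ 3 + 75 * pinchukF * pinchukH ^ 3 + C (75 / 4 : ℝ) * pinchukH ^ 4

/-- `Q = q − u`. -/
def pinchukQ : MvPolynomial (Fin 2) ℝ := pinchukq - pinchukU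

/-- `ℝ(x, y)`, the fraction field of `ℝ[x, y]`. -/
abbrev RxY := FractionRing (MvPolynomial (Fin 2) ℝ)

/-- `P`, `Q` and `h` as elements of `ℝ(x, y)`. -/
def aP : RxY := algebraMap (MvPolynomial (Fin 2) ℝ) RxY pinchukP
def aQ : RxY := algebraMap (MvPolynomial (Fin 2) ℝ) RxY pinchukQ
def aH : RxY := algebraMap (MvPolynomial (Fin 2) ℝ) RxY pinchukH

/-- The subfield `ℝ(P, Q)` of `ℝ(x, y)`. -/
def RPQ : IntermediateField ℝ RxY := IntermediateField.adjoin ℝ ({aP, aQ} : Set RxY)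

/-- The explicit sextic
`R(T) = (197/4)T⁶ + (104 − (363/2)P)T⁵ + (63 − 421P + (825/4)P²)T⁴
  + (−306P + 510P² − 75P³)T³ + (−Q + 412P² − 195P³)T² + (2PQ − 170P³)T − P²Q`. -/
def pinchukR : Polynomial RxY :=
  Polynomial.C (197 / 4 : RxY) * Polynomial.X ^ 6 +
  Polynomial.C ((104 : RxY) - (363 / 2 : RxY) * aP) * Polynomial.X ^ 5 +
  Polynomial.C ((63 : RxY) - 421 * aP + (825 / 4 : RxY) * aP ^ 2) * Polynomial.X ^ 4 +
  Polynomial.C (-306 * aP + 510 * aP ^ 2 - 75 * aP ^ 3) * Polynomial.X ^ 3 +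
  Polynomial.C (-aQ + 412 * aP ^ 2 - 195 * aP ^ 3) * Polynomial.X ^ 2 +
  Polynomial.C (2 * aP * aQ - 170 * aP ^ 3) * Polynomial.X +
  Polynomial.C (-(aP ^ 2 * aQ))

/-- The sextic with parameters in an arbitrary `ℝ`-algebra. -/
def genR (A : Type*) [CommRing A] [Algebra ℝ A] (p q : A) : Polynomial A :=
  Polynomial.C (algebraMap ℝ A (197 / 4)) * Polynomial.X ^ 6 +
  Polynomial.C (104 - algebraMap ℝ A (363 / 2) * p) * Polynomial.X ^ 5 +
  Polynomial.C (63 - 421 * p + algebraMap ℝ A (825 / 4) * p ^ 2) * Polynomial.X ^ 4 +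
  Polynomial.C (-306 * p + 510 * p ^ 2 - 75 * p ^ 3) * Polynomial.X ^ 3 +
  Polynomial.C (-q + 412 * p ^ 2 - 195 * p ^ 3) * Polynomial.X ^ 2 +
  Polynomial.C (2 * p * q - 170 * p ^ 3) * Polynomial.X +
  Polynomial.C (-(p ^ 2 * q))

theorem genR_map (A B : Type*) [CommRing A] [Algebra ℝ A] [CommRing B] [Algebra ℝ B]
    (φ : A →+* B) (hφ : ∀ r : ℝ, φ (algebraMap ℝ A r) = algebraMap ℝ B r) (p q : A) :
    (genR A p q).map φ = genR B (φ p) (φ q) := by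
  simp only [genR, hφ, Polynomial.map_add, Polynomial.map_mul, Polynomial.map_C,
    Polynomial.map_pow, Polynomial.map_X, Polynomial.map_sub, Polynomial.map_neg, map_add, map_sub, map_mul, map_neg, map_pow,
    map_ofNat φ]

theorem genR_RxY : genR RxY aP aQ = pinchukR := by
  have (m n : ℝ) : algebraMap ℝ RxY (m / n) = algebraMap ℝ RxY m / algebraMap ℝ RxY n :=
    map_div₀ _ _ _
  simp only [genR, pinchukR, this, map_ofNat (algebraMap ℝ RxY)]

theorem genR_degree (A : Type*) [CommRing A] [Algebra ℝ A] [Nontrivial A] (p q : A) :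
    (genR A p q).natDegree = 6 := by
  have : algebraMap ℝ A (197 / 4) ≠ 0 := by
    rw [map_ne_zero_iff _ (FaithfulSMul.algebraMap_injective ℝ A)]; norm_num
  unfold genR
  compute_degree!

theorem genR_lead (A : Type*) [CommRing A] [Algebra ℝ A] [Nontrivial A] (p q : A) :
    (genR A p q).leadingCoeff = algebraMap ℝ A (197 / 4) := by
  rw [Polynomial.leadingCoeff, genR_degree]
  simp only [genR, Polynomial.coeff_add, Polynomial.coeff_C_mul, Polynomial.coeff_X,
    Polynomial.coeff_C, Polynomial.coeff_X_pow]
  norm_num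

theorem eval_R : Polynomial.eval aH pinchukR = 0 := by
  have h1 : Polynomial.eval pinchukH (genR _ pinchukP pinchukQ) = 0 := by
    have e : (C (197/4 : ℝ) : MvPolynomial (Fin 2) ℝ) = 197 * C (1/4 : ℝ) := by
      rw [← map_ofNat (C : ℝ →+* MvPolynomial (Fin 2) ℝ) 197, ← C_mul]; norm_num
    have e1 : (C (363/2 : ℝ) : MvPolynomial (Fin 2) ℝ) = 726 * C (1/4 : ℝ) := by
      rw [← map_ofNat (C : ℝ →+* MvPolynomial (Fin 2) ℝ) 726, ← C_mul]; norm_num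
    have e2 : (C (825/4 : ℝ) : MvPolynomial (Fin 2) ℝ) = 825 * C (1/4 : ℝ) := by
      rw [← map_ofNat (C : ℝ →+* MvPolynomial (Fin 2) ℝ) 825, ← C_mul]; norm_num
    have e3 : (C (75/4 : ℝ) : MvPolynomial (Fin 2) ℝ) = 75 * C (1/4 : ℝ) := by
      rw [← map_ofNat (C : ℝ →+* MvPolynomial (Fin 2) ℝ) 75, ← C_mul]; norm_num
    have e4 : (4 : MvPolynomial (Fin 2) ℝ) * C (1/4 : ℝ) = 1 := by
      rw [← map_ofNat (C : ℝ →+* MvPolynomial (Fin 2) ℝ) 4, ← C_mul]; norm_num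
    simp only [genR, Polynomial.eval_add, Polynomial.eval_mul, Polynomial.eval_C,
      Polynomial.eval_pow, Polynomial.eval_X, MvPolynomial.algebraMap_eq, e, e1, e2,
      pinchukP, pinchukQ, pinchukq, pinchukU, e3]
    -- relations among f, h, t
    have r1 : pinchukF * pinchukT =
        pinchukF * pinchukH - pinchukH ^ 2 * (pinchukH + 1) := by
      simp only [pinchukF, pinchukH, pinchukT]; ring
    generalize pinchukF = f at *
    generalize pinchukH = h at *
    generalize pinchukT = t at *
    linear_combination (f * t + (f * h - h ^ 2 * (h + 1)) + 6 * f * h * (h + 1)) * r1 +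
      (74 * h ^ 6 + 231 * f * h ^ 5 + 225 * f ^ 2 * h ^ 4) * e4
  rw [← genR_RxY]
  have := genR_map _ RxY (algebraMap (MvPolynomial (Fin 2) ℝ) RxY) (fun r => by
    rw [← IsScalarTower.algebraMap_apply]) pinchukP pinchukQ
  unfold aP aQ aH
  rw [← this, Polynomial.eval_map_algebraMap, Polynomial.aeval_algebraMap_apply]
  simp [Polynomial.aeval_def, Polynomial.eval₂_id, h1]

theorem alg_indep : AlgebraicIndependent ℝ ![aP, aH] := by
  rw [algebraicIndependent_iff]
  intro g hg
  have h1 : aeval ![pinchukP, pinchukH] g = 0 := by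
    apply IsFractionRing.injective (MvPolynomial (Fin 2) ℝ) RxY
    rw [map_zero, ← hg, ← MvPolynomial.aeval_algebraMap_apply]
    congr 2
    ext i; fin_cases i <;> rfl
  have h2 : ∀ v : Fin 2 → ℝ, eval ![eval v pinchukP, eval v pinchukH] g = 0 := by
    intro v
    have := congrArg (aeval v : MvPolynomial (Fin 2) ℝ →ₐ[ℝ] ℝ) h1
    rw [map_zero, ← AlgHom.comp_apply, comp_aeval] at this
    rw [← this, ← MvPolynomial.coe_aeval_eq_eval, RingHom.coe_coe]
    congr 2
    ext i; fin_cases i <;> rfl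
  have h3 : g * ((X 0 - X 1) * X 1 * (X 1 + 1) * (X 0 - X 1 - X 1 * (X 1 + 1))) = 0 := by
    apply MvPolynomial.funext
    intro v
    simp only [map_mul, map_sub, map_add, eval_X, map_one, map_zero]
    by_cases hc : v 0 - v 1 = 0
    · simp [hc]
    by_cases hb : v 1 = 0
    · simp [hb]
    by_cases hb1 : v 1 + 1 = 0
    · simp [hb1]
    by_cases hd : v 0 - v 1 - v 1 * (v 1 + 1) = 0
    · simp [hd]
    have key : ∃ w : Fin 2 → ℝ, eval w pinchukP = v 0 ∧ eval w pinchukH = v 1 := by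
      generalize hb' : v 1 = b at *
      generalize hc' : v 0 - b = c at *
      have h0 : v 0 = c + b := by rw [← hc']; ring
      rw [h0]
      generalize hd' : c - b * (b + 1) = d at *
      have hs : c / d ≠ 0 := div_ne_zero hc hd
      -- s = c/d, t = b d / c, s - 1 = b (b+1)/d, x = (b+1) c / d^2, y = (t+1)/x
      have hT : eval ![(b+1)*c/d^2, (b*d/c+1)*d^2/((b+1)*c)] pinchukT = b*d/c := by
        simp [pinchukT]; field_simp; ring
      have hH : eval ![(b+1)*c/d^2, (b*d/c+1)*d^2/((b+1)*c)] pinchukH = b := by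
        simp only [pinchukH, map_mul, map_add, hT, eval_X, map_one]; simp; field_simp
        rw [← hd']; ring
      refine ⟨![(b+1)*c/d^2, (b*d/c+1)*d^2/((b+1)*c)], ?_, hH⟩
      rw [pinchukP, map_add, hH]
      simp only [pinchukF, map_mul, map_add, map_pow, hT, eval_X, map_one]; simp; field_simp
      have : c = d + b * (b + 1) := by rw [← hd']; ring
      rw [this]; ring
    obtain ⟨w, hw0, hw1⟩ := key
    have := h2 w
    rw [hw0, hw1] at this
    rw [show v = ![v 0, v 1] by ext i; fin_cases i <;> rfl]
    rw [this]; simp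
  rcases mul_eq_zero.1 h3 with h | h
  · exact h
  · exfalso
    have := congrArg (eval ![5, 1]) h
    simp at this
    norm_num at this

open IntermediateField algebraAdjoinAdjoin in
theorem trans_H : Transcendental ℝ⟮aP⟯ aH := by
  have h := alg_indep.transcendental_adjoin (s := {0}) (i := 1) (by simp)
  have hs : (![aP, aH] '' ({0} : Set (Fin 2))) = {aP} := by
    ext z; simp
  erw [hs] at h
  intro h'
  apply h
  exact (IsFractionRing.isAlgebraic_iff (Algebra.adjoin ℝ {aP}) ℝ⟮aP⟯ RxY).2 h'

open Polynomial IntermediateField.algebraAdjoinAdjoin in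
/-- linear-in-`Q` irreducibility -/
theorem irr_gen {K L : Type*} [Field K] [Field L] [Algebra K L] (f : L) (hf : Transcendental K f)
    (num den : K[X]) (hden : den ≠ 0) (hco : IsCoprime num den)
    (hdeg : den.natDegree < num.natDegree) :
    Irreducible (num.map (algebraMap K (IntermediateField.adjoin K {f})) -
      Polynomial.C (IntermediateField.AdjoinSimple.gen K f) *
      den.map (algebraMap K (IntermediateField.adjoin K {f}))) := by
  have : UniqueFactorizationMonoid (Algebra.adjoin K {f}) :=
    hf.uniqueFactorizationMonoid_adjoin
  let A := Algebra.adjoin K {f}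
  let q : A := ⟨f, Algebra.self_mem_adjoin_singleton K f⟩
  let ψ : A[X] := num.map (algebraMap K A) - Polynomial.C q * den.map (algebraMap K A)
  have hψ : Irreducible ψ := by
    let e := Polynomial.algEquivOfTranscendental K f hf
    let φ : K[X][X] := num.map (algebraMap ..) -
      Polynomial.C Polynomial.X * den.map (algebraMap ..)
    have φ_map : φ.mapEquiv e.toRingEquiv = ψ := by
      simp only [algebraMap_eq, map_sub, mapEquiv_apply,
        AlgEquiv.toRingEquiv_toRingHom, algEquivOfTranscendental_coe, Polynomial.map_map, map_mul,
        Polynomial.map_C, RingHom.coe_coe, Polynomial.aeval_X, e, φ, ψ]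
      congr 2 <;> ext <;> simp [q]
    rw [← φ_map, MulEquiv.irreducible_iff]
    have : φ = Bivariate.swap
        (Polynomial.C num - Polynomial.X * Polynomial.C den) := by
      rw [map_sub, map_mul, Bivariate.swap_C, Bivariate.swap_C, Bivariate.swap_Y]
      rfl
    rw [this, MulEquiv.irreducible_iff]
    convert!
      irreducible_C_mul_X_add_C (neg_ne_zero.mpr hden)
        ((IsCoprime.neg_right_iff _ _).mpr hco).symm.isRelPrime using 1
    rw [add_comm, X_mul_C, map_neg, neg_mul]
    exact sub_eq_add_neg _ _
  have hnd : ψ.natDegree ≠ 0 := by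
    have h1 : (num.map (algebraMap K A)).natDegree = num.natDegree :=
      natDegree_map_eq_of_injective (FaithfulSMul.algebraMap_injective K A) _
    have h2 : (Polynomial.C q * den.map (algebraMap K A)).natDegree ≤ den.natDegree :=
      (natDegree_C_mul_le _ _).trans natDegree_map_le
    have : ψ.natDegree = num.natDegree := by
      rw [← h1]
      exact natDegree_sub_eq_left_of_natDegree_lt (by omega)
    omega
  have := (IsPrimitive.irreducible_iff_irreducible_map_fraction_map
    (K := IntermediateField.adjoin K {f}) (hψ.isPrimitive hnd)).1 hψ
  convert! this using 1
  simp [ψ, Polynomial.map_map, q]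
  rfl

open IntermediateField in
theorem trans_Q : Transcendental ℝ⟮aP⟯ aQ := by
  intro hQ
  apply trans_H
  have h1 : Algebra.IsAlgebraic ℝ⟮aP⟯ ℝ⟮aP⟯⟮aQ⟯ := isAlgebraic_adjoin_simple hQ.isIntegral
  have h2 : IsAlgebraic ℝ⟮aP⟯⟮aQ⟯ aH := by
    let p : ℝ⟮aP⟯⟮aQ⟯ := algebraMap ℝ⟮aP⟯ _ (AdjoinSimple.gen ℝ aP)
    let q : ℝ⟮aP⟯⟮aQ⟯ := AdjoinSimple.gen _ aQ
    refine ⟨genR _ p q, ?_, ?_⟩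
    · intro h
      have := genR_degree _ p q
      rw [h] at this
      simp at this
    · rw [← Polynomial.eval_map_algebraMap, genR_map _ RxY _ (fun r => by rfl)]
      exact genR_RxY ▸ eval_R
  exact h2.restrictScalars ℝ⟮aP⟯

theorem aP_ne (r : ℝ) : aP ≠ algebraMap ℝ RxY r := by
  intro h
  have h := (alg_indep.transcendental 0)
  apply h
  simp only [Matrix.cons_val_zero]
  rw [‹aP = _›]
  exact isAlgebraic_algebraMap r

open IntermediateField in
theorem irr1 : Irreducible (genR ℝ⟮aP⟯⟮aQ⟯ (algebraMap ℝ⟮aP⟯ _ (AdjoinSimple.gen ℝ aP))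
    (AdjoinSimple.gen _ aQ)) := by
  set p := AdjoinSimple.gen ℝ aP with hp
  have hp0 : p ≠ 0 := by
    intro h
    apply aP_ne 0
    have := congrArg (algebraMap ℝ⟮aP⟯ RxY) h
    simpa [hp] using this
  have hp1 : p + 1 ≠ 0 := by
    intro h
    apply aP_ne (-1)
    have := congrArg (algebraMap ℝ⟮aP⟯ RxY) (eq_neg_of_add_eq_zero_left h)
    simpa [hp] using this
  have hdeg := genR_degree ℝ⟮aP⟯ p 0
  have := irr_gen aQ trans_Q (genR ℝ⟮aP⟯ p 0) ((Polynomial.X - Polynomial.C p) ^ 2)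
    (pow_ne_zero _ (Polynomial.X_sub_C_ne_zero p)) (by
      apply IsCoprime.pow_right
      apply IsCoprime.symm
      rw [(Polynomial.irreducible_X_sub_C p).coprime_iff_not_dvd, Polynomial.dvd_iff_isRoot]
      intro h
      have h2 : p ^ 4 * (p + 1) ^ 2 = 0 := by
        have hd (m n : ℝ) : algebraMap ℝ ℝ⟮aP⟯ (m / n) =
          algebraMap ℝ ℝ⟮aP⟯ m / algebraMap ℝ ℝ⟮aP⟯ n := map_div₀ _ _ _
        simp only [genR, Polynomial.IsRoot, Polynomial.eval_add, Polynomial.eval_mul,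
          Polynomial.eval_C, Polynomial.eval_pow, Polynomial.eval_X, hd,
          map_ofNat (algebraMap ℝ ℝ⟮aP⟯)] at h
        linear_combination -h
      exact mul_ne_zero (pow_ne_zero _ hp0) (pow_ne_zero _ hp1) h2)
    (by rw [hdeg, Polynomial.natDegree_pow, Polynomial.natDegree_X_sub_C]; norm_num)
  convert! this using 1
  rw [genR_map _ ℝ⟮aP⟯⟮aQ⟯ _ (fun r => by rfl)]
  simp only [genR, Polynomial.map_pow, Polynomial.map_sub, Polynomial.map_X, Polynomial.map_C,
    map_zero, map_add, map_sub, map_mul, map_neg, map_pow, neg_zero]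
  simp only [map_ofNat (Polynomial.C : ℝ⟮aP⟯⟮aQ⟯ →+* _)]
  ring

def pP : RPQ := ⟨aP, IntermediateField.subset_adjoin _ _ (by simp)⟩
def pQ : RPQ := ⟨aQ, IntermediateField.subset_adjoin _ _ (by simp)⟩

open IntermediateField in
theorem irr2 : Irreducible (genR RPQ pP pQ) := by
  have hE : RPQ = ℝ⟮aP⟯⟮aQ⟯.restrictScalars ℝ := (adjoin_simple_adjoin_simple ℝ aP aQ).symm
  have hm : ∀ x : RxY, x ∈ RPQ ↔ x ∈ ℝ⟮aP⟯⟮aQ⟯ := by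
    intro x; rw [hE]; rfl
  let e : RPQ ≃+* ℝ⟮aP⟯⟮aQ⟯ :=
    { toFun := fun x => ⟨x.1, (hm _).1 x.2⟩
      invFun := fun x => ⟨x.1, (hm _).2 x.2⟩
      left_inv := fun x => rfl
      right_inv := fun x => rfl
      map_mul' := fun x y => rfl
      map_add' := fun x y => rfl }
  rw [← MulEquiv.irreducible_iff (Polynomial.mapEquiv e)]
  rw [Polynomial.mapEquiv_apply, genR_map _ ℝ⟮aP⟯⟮aQ⟯ _ (fun r => by rfl)]
  exact irr1

theorem minpoly_eq : Polynomial.C (197 / 4 : RPQ) * minpoly RPQ aH = genR RPQ pP pQ := by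
  have h0 : Polynomial.aeval aH (genR RPQ pP pQ) = 0 := by
    rw [← Polynomial.eval_map_algebraMap, genR_map _ RxY _ (fun r => by rfl)]
    exact genR_RxY ▸ eval_R
  rw [← minpoly.eq_of_irreducible irr2 h0, genR_lead, mul_comm, mul_assoc, ← Polynomial.C_mul]
  have hd : algebraMap ℝ RPQ (197 / 4) = 197 / 4 := by
    rw [map_div₀, map_ofNat (algebraMap ℝ RPQ), map_ofNat (algebraMap ℝ RPQ)]
  rw [hd, inv_mul_cancel₀ (by norm_num), Polynomial.C_1, mul_one]

theorem int_H : IsIntegral (Algebra.adjoin ℝ ({aP, aQ} : Set RxY)) aH := by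
  let A := Algebra.adjoin ℝ ({aP, aQ} : Set RxY)
  let p : A := ⟨aP, Algebra.subset_adjoin (by simp)⟩
  let q : A := ⟨aQ, Algebra.subset_adjoin (by simp)⟩
  refine ⟨Polynomial.C (algebraMap ℝ A (4 / 197)) * genR A p q, ?_, ?_⟩
  · apply Polynomial.monic_C_mul_of_mul_leadingCoeff_eq_one
    rw [genR_lead, ← map_mul]; norm_num
  · rw [← Polynomial.aeval_def, map_mul]
    have : Polynomial.aeval aH (genR A p q) = 0 := by
      rw [← Polynomial.eval_map_algebraMap, genR_map _ RxY _ (fun r => by rfl)]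
      exact genR_RxY ▸ eval_R
    rw [this, mul_zero]

/-- `h` is integral over the subring `ℝ[P, Q]` of `ℝ(x, y)`, and the monic
minimal polynomial `m(T)` of `h` over the field `ℝ(P, Q)` satisfies `(197/4)·m(T) = R(T)`,
where `R(T)` is the explicit sextic above.  In particular `R(h) = 0` in `ℝ(x, y)` and
`R(T)` is irreducible in `ℝ(P, Q)[T]`. -/
theorem pinchuk_minimal_polynomial :
    IsIntegral (Algebra.adjoin ℝ ({aP, aQ} : Set RxY)) aH ∧
    (Polynomial.C (197 / 4 : RPQ) * minpoly RPQ aH).map (algebraMap RPQ RxY) = pinchukR ∧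
    Polynomial.eval aH pinchukR = 0 ∧
    Irreducible (Polynomial.C (197 / 4 : RPQ) * minpoly RPQ aH) := by
  
  refine ⟨int_H, ?_, eval_R, ?_⟩
  · rw [minpoly_eq, genR_map _ RxY _ (fun r => by rfl)]
    exact genR_RxY
  · rw [minpoly_eq]
    exact irr2
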